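/- arXiv:2103.02271 — 3 statements merged into one kernel-verified Lean document; each statement's English description precedes it below -/
import Mathlib

section
/- The averaged iterates of the distributed proximal gradient algorithm converge to the set of critical points in the following sense: there exists a sequence (d_{k+1})_{k≥1} with d_{k+1} ∈ ∂_{ε_{k+1}} h(x̄_{k+1}) for every k ≥ 1 such that lim_{k→∞} ‖∇g(x̄_{k+1}) + d_{k+1}‖ = 0. -/
open scoped RealInnerProductSpace
open Filter

section Auxiliary

variable {E : Type*} [NormedAddCommGroup E] [InnerProductSpace ℝ E]

/-- A minimizer `p` of `z ↦ h z + ‖z - w‖² / (2α)` has `α⁻¹ • (w - p)` as a subgradient of `h`. -/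
theorem subgradient_of_prox {h : E → ℝ} (hconv : ConvexOn ℝ Set.univ h) {α : ℝ} {w p : E}
    (hp : ∀ z, h p + (1 / (2 * α)) * ‖p - w‖ ^ 2 ≤ h z + (1 / (2 * α)) * ‖z - w‖ ^ 2) (u : E) :
    h p + ⟪α⁻¹ • (w - p), u - p⟫ ≤ h u := by
  have key : ∀ t ∈ Set.Ioo (0 : ℝ) 1,
      h p + ⟪α⁻¹ • (w - p), u - p⟫ ≤ h u + t * ((1 / (2 * α)) * ‖u - p‖ ^ 2) := by
    rintro t ⟨ht0, ht1⟩
    have h1 := hp ((1 - t) • p + t • u)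
    have h2 := hconv.2 (Set.mem_univ p) (Set.mem_univ u) (by linarith : 0 ≤ 1 - t) ht0.le (by ring)
    have h3 : (1 - t) • p + t • u - w = (p - w) + t • (u - p) := by module
    have h4 : ‖(p - w) + t • (u - p)‖ ^ 2
        = ‖p - w‖ ^ 2 + 2 * (t * ⟪p - w, u - p⟫) + t ^ 2 * ‖u - p‖ ^ 2 := by
      rw [norm_add_sq_real, inner_smul_right, norm_smul, mul_pow, Real.norm_eq_abs, sq_abs]
    have h5 : ⟪α⁻¹ • (w - p), u - p⟫ = -(α⁻¹ * ⟪p - w, u - p⟫) := by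
      rw [inner_smul_left, ← neg_sub p w, inner_neg_left]
      simp
    have h6 : (1 / (2 * α)) = α⁻¹ / 2 := by rw [one_div, mul_inv]; ring
    rw [h3, h4, h6] at h1
    rw [h5, h6]
    simp only [smul_eq_mul] at h2
    refine le_of_mul_le_mul_left ?_ ht0
    linarith
  have hlim : Tendsto (fun t : ℝ => h u + t * ((1 / (2 * α)) * ‖u - p‖ ^ 2))
      (nhdsWithin 0 (Set.Ioi 0)) (nhds (h u)) := by
    have : Continuous fun t : ℝ => h u + t * ((1 / (2 * α)) * ‖u - p‖ ^ 2) := by fun_prop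
    simpa using (this.tendsto 0).mono_left nhdsWithin_le_nhds
  exact ge_of_tendsto hlim (eventually_of_mem (Ioo_mem_nhdsGT one_pos) key)

/-- If `α⁻¹ • (w - P w)` is a subgradient of `h` at `P w` for every `w`, then `P` is
nonexpansive. -/
theorem nonexpansive_of_subgradient {h : E → ℝ} {α : ℝ} (hα : 0 < α) {P : E → E}
    (hP : ∀ w u, h (P w) + ⟪α⁻¹ • (w - P w), u - P w⟫ ≤ h u) (a b : E) :
    ‖P a - P b‖ ≤ ‖a - b‖ := by
  have h1 := hP a (P b)
  have h2 := hP b (P a)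
  rw [real_inner_smul_left] at h1 h2
  have h3 : ⟪a - P a, P b - P a⟫ + ⟪b - P b, P a - P b⟫ ≤ 0 := by
    have : α⁻¹ * (⟪a - P a, P b - P a⟫ + ⟪b - P b, P a - P b⟫) ≤ 0 := by linarith
    by_contra! hc
    exact absurd this (not_le.2 (mul_pos (inv_pos.2 hα) hc))
  have h4 : ⟪a - P a, P b - P a⟫ + ⟪b - P b, P a - P b⟫
      = ‖P a - P b‖ ^ 2 - ⟪a - b, P a - P b⟫ := by
    rw [← real_inner_self_eq_norm_sq]
    simp only [inner_sub_left, inner_sub_right]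
    ring
  have h5 := real_inner_le_norm (a - b) (P a - P b)
  by_contra! hc
  nlinarith [norm_nonneg (a - b)]

/-- A continuous convex function is `K`-Lipschitz if its subgradients at the points `P w` are
bounded by `K` for a map `P` at bounded distance from the identity. -/
theorem lipschitz_of_subgradient_bound {h : E → ℝ} (hconv : ConvexOn ℝ Set.univ h)
    (hcont : Continuous h) {K R : ℝ} {P s : E → E}
    (hs : ∀ w u, h (P w) + ⟪s w, u - P w⟫ ≤ h u) (hK : ∀ w, ‖s w‖ ≤ K)
    (hR : ∀ w, ‖P w - w‖ ≤ R) (y z : E) : h y ≤ h z + K * ‖y - z‖ := by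
  let c : ℝ → E := fun t => t⁻¹ • (P (y + t • (y - z)) - (y + t • (y - z)))
  have hc : Tendsto c atTop (nhds 0) := by
    have hb : Tendsto (fun t : ℝ => t⁻¹ * R) atTop (nhds 0) := by
      simpa using tendsto_inv_atTop_zero.mul_const R
    refine squeeze_zero_norm' ?_ hb
    filter_upwards [eventually_gt_atTop 0] with t ht
    rw [norm_smul, norm_inv, Real.norm_of_nonneg ht.le]
    exact mul_le_mul_of_nonneg_left (hR _) (inv_pos.2 ht).le
  have hlim : Tendsto (fun t => h (z - c t) + K * ‖y - (z - c t)‖) atTop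
      (nhds (h z + K * ‖y - z‖)) := by
    have hφ : Continuous fun b => h (z - b) + K * ‖y - (z - b)‖ := by fun_prop
    have := (hφ.tendsto 0).comp hc
    simp only [sub_zero] at this
    exact this
  refine ge_of_tendsto hlim ?_
  filter_upwards [eventually_gt_atTop 0] with t ht
  set w := y + t • (y - z) with hw
  have hPw : P w - (z - c t) = (1 + t) • (y - (z - c t)) := by
    have : P w = w + t • c t := by
      simp only [c, ← hw, smul_smul, mul_inv_cancel₀ ht.ne', one_smul]; abel
    rw [this, hw]; module
  have hy : y = (1 / (1 + t)) • P w + (t / (1 + t)) • (z - c t) := by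
    have : P w = (1 + t) • (y - (z - c t)) + (z - c t) := by rw [← hPw]; abel
    rw [this, smul_add, smul_smul, one_div_mul_cancel (by linarith), one_smul]
    have h1 : (1 / (1 + t)) • (z - c t) + (t / (1 + t)) • (z - c t) = z - c t := by
      rw [← add_smul, ← add_div, div_self (by linarith), one_smul]
    rw [add_assoc, h1]; abel
  have h1 := hconv.2 (Set.mem_univ (P w)) (Set.mem_univ (z - c t))
    (by positivity : 0 ≤ 1 / (1 + t)) (by positivity : 0 ≤ t / (1 + t)) (by field_simp)
  rw [← hy] at h1
  have h2 : h (P w) ≤ h (z - c t) + (1 + t) * (K * ‖y - (z - c t)‖) := by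
    have h3 := hs w (z - c t)
    have h4 := (abs_real_inner_le_norm (s w) (z - c t - P w)).trans
      (mul_le_mul_of_nonneg_right (hK w) (norm_nonneg _))
    rw [norm_sub_rev, hPw, norm_smul, Real.norm_of_nonneg (by linarith)] at h4
    linarith [neg_le_of_abs_le h4]
  calc h y ≤ 1 / (1 + t) * h (P w) + t / (1 + t) * h (z - c t) := h1
    _ ≤ 1 / (1 + t) * (h (z - c t) + (1 + t) * (K * ‖y - (z - c t)‖))
        + t / (1 + t) * h (z - c t) := by gcongr
    _ = h (z - c t) + K * ‖y - (z - c t)‖ := by field_simp; ring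

variable [CompleteSpace E]

theorem HasGradientAt.hasDerivAt_line {g : E → ℝ} {G : E → E}
    (hg : ∀ x, HasGradientAt g (G x) x) (y w : E) (t : ℝ) :
    HasDerivAt (fun t : ℝ => g (y + t • w)) ⟪G (y + t • w), w⟫ t := by
  have h1 : HasDerivAt (fun t : ℝ => y + t • w) w t := by
    simpa using ((hasDerivAt_id t).smul_const w).const_add y
  have h2 := (hg (y + t • w)).hasFDerivAt.comp_hasDerivAt t h1
  rw [InnerProductSpace.toDual_apply_apply] at h2
  exact h2

/-- The descent lemma for functions with Lipschitz gradient. -/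
theorem descent_of_lipschitz_gradient {g : E → ℝ} {G : E → E} {L : ℝ}
    (hg : ∀ x, HasGradientAt g (G x) x) (hL : ∀ x y, ‖G x - G y‖ ≤ L * ‖x - y‖) (y z : E) :
    g z ≤ g y + ⟪G y, z - y⟫ + L / 2 * ‖z - y‖ ^ 2 := by
  set w := z - y with hw
  let ψ : ℝ → ℝ := fun t => g (y + t • w) - (t * ⟪G y, w⟫ + t ^ 2 * (L / 2 * ‖w‖ ^ 2))
  have hψ : ∀ t, HasDerivAt ψ
      (⟪G (y + t • w), w⟫ - (⟪G y, w⟫ + 2 * t * (L / 2 * ‖w‖ ^ 2))) t := by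
    intro t
    have h1 : HasDerivAt (fun t : ℝ => t * ⟪G y, w⟫) ⟪G y, w⟫ t := by
      simpa using (hasDerivAt_id t).mul_const ⟪G y, w⟫
    have h2 : HasDerivAt (fun t : ℝ => t ^ 2 * (L / 2 * ‖w‖ ^ 2))
        (2 * t * (L / 2 * ‖w‖ ^ 2)) t := by
      simpa using (hasDerivAt_pow 2 t).mul_const (L / 2 * ‖w‖ ^ 2)
    exact (HasGradientAt.hasDerivAt_line hg y w t).fun_sub (h1.fun_add h2)
  have hanti : AntitoneOn ψ (Set.Icc 0 1) := by
    refine antitoneOn_of_deriv_nonpos (convex_Icc 0 1)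
      (fun t _ => (hψ t).continuousAt.continuousWithinAt)
      (fun t _ => (hψ t).differentiableAt.differentiableWithinAt) fun t ht => ?_
    rw [interior_Icc] at ht
    rw [(hψ t).deriv]
    have h1 := real_inner_le_norm (G (y + t • w) - G y) w
    have h2 := hL (y + t • w) y
    rw [add_sub_cancel_left, norm_smul, Real.norm_of_nonneg ht.1.le] at h2
    have h3 := mul_le_mul_of_nonneg_right h2 (norm_nonneg w)
    rw [inner_sub_left] at h1
    linarith
  have h01 := hanti (Set.left_mem_Icc.2 zero_le_one) (Set.right_mem_Icc.2 zero_le_one) zero_le_one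
  simp only [ψ, zero_smul, one_smul, add_zero, hw, add_sub_cancel] at h01
  linarith

/-- A function with gradient bounded by `K` is `K`-Lipschitz. -/
theorem abs_sub_le_of_gradient_bound {g : E → ℝ} {G : E → E} {K : ℝ}
    (hg : ∀ x, HasGradientAt g (G x) x) (hK : ∀ x, ‖G x‖ ≤ K) (y z : E) :
    |g z - g y| ≤ K * ‖z - y‖ :=
  convex_univ.norm_image_sub_le_of_norm_hasFDerivWithin_le
    (fun x _ => (hg x).hasFDerivAt.hasFDerivWithinAt) (fun x _ => by simpa using hK x)
    (Set.mem_univ y) (Set.mem_univ z)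

theorem HasGradientAt.average {m : ℕ} {g : Fin m → E → ℝ} {G : Fin m → E} {x : E}
    (hg : ∀ i, HasGradientAt (g i) (G i) x) :
    HasGradientAt (fun y => (m : ℝ)⁻¹ * ∑ i, g i y) ((m : ℝ)⁻¹ • ∑ i, G i) x := by
  rw [hasGradientAt_iff_hasFDerivAt]
  have h1 := (HasFDerivAt.fun_sum fun i (_ : i ∈ Finset.univ) => (hg i).hasFDerivAt).const_mul
    (m : ℝ)⁻¹
  simpa [map_sum] using h1

end Auxiliary

section Average

variable {E : Type*} [NormedAddCommGroup E] [NormedSpace ℝ E] {m : ℕ}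

theorem norm_average_le (hm : 1 ≤ m) {w : Fin m → E} {C : ℝ} (hw : ∀ i, ‖w i‖ ≤ C) :
    ‖(m : ℝ)⁻¹ • ∑ i, w i‖ ≤ C := by
  have hm' : (0 : ℝ) < m := by exact_mod_cast hm
  have h1 : ‖∑ i, w i‖ ≤ m * C := by
    simpa using norm_sum_le_of_le Finset.univ fun i _ => hw i
  rw [norm_smul, norm_inv, Real.norm_of_nonneg hm'.le, inv_mul_le_iff₀ hm']
  exact h1

theorem average_sub_const (hm : 1 ≤ m) (w : Fin m → E) (c : E) :
    (m : ℝ)⁻¹ • ∑ i, (w i - c) = (m : ℝ)⁻¹ • ∑ i, w i - c := by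
  have hm' : (m : ℝ) ≠ 0 := by exact_mod_cast (Nat.one_le_iff_ne_zero.1 hm)
  rw [Finset.sum_sub_distrib, smul_sub]
  simp [← Nat.cast_smul_eq_nsmul ℝ, smul_smul, hm']

theorem average_sub_average (w w' : Fin m → E) :
    (m : ℝ)⁻¹ • ∑ i, (w i - w' i) = (m : ℝ)⁻¹ • ∑ i, w i - (m : ℝ)⁻¹ • ∑ i, w' i := by
  rw [Finset.sum_sub_distrib, smul_sub]

end Average

/-- In a quasi-descent inequality with summable errors the decrements tend to zero. -/
theorem tendsto_zero_of_quasi_descent {a b c : ℕ → ℝ} {A : ℝ} (ha : ∀ k, A ≤ a k)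
    (hb : ∀ k, 0 ≤ b k) (hc0 : ∀ k, 0 ≤ c k) (hc : Summable c)
    (hstep : ∀ k, a (k + 1) ≤ a k - b k + c k) : Tendsto b atTop (nhds 0) := by
  have hsum : ∀ N, ∑ k ∈ Finset.range N, b k ≤ a 0 - a N + ∑ k ∈ Finset.range N, c k := by
    intro N
    induction N with
    | zero => simp
    | succ N ih => rw [Finset.sum_range_succ, Finset.sum_range_succ]; linarith [hstep N]
  refine (summable_of_sum_range_le (c := a 0 - A + ∑' k, c k) hb fun N => ?_).tendsto_atTop_zero
  linarith [hsum N, ha N, hc.sum_le_tsum (Finset.range N) fun k _ => hc0 k]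

theorem stmt_17
    (n m : ℕ) (hn : 0 < n) (hm : 1 ≤ m)
    (g : Fin m → EuclideanSpace ℝ (Fin n) → ℝ)
    (G : Fin m → EuclideanSpace ℝ (Fin n) → EuclideanSpace ℝ (Fin n))
    (L Gg Gh α : ℝ) (hL : 0 < L)
    (hgrad : ∀ i x, HasGradientAt (g i) (G i x) x)
    (hLip : ∀ i x y, ‖G i x - G i y‖ ≤ L * ‖x - y‖)
    (hGg : ∀ i x, ‖G i x‖ ≤ Gg)
    (h : EuclideanSpace ℝ (Fin n) → ℝ)
    (hconv : ConvexOn ℝ Set.univ h)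
    (hGh : 0 < Gh)
    (hsub : ∀ x z : EuclideanSpace ℝ (Fin n), (∀ u, h x + ⟪z, u - x⟫ ≤ h u) → ‖z‖ ≤ Gh)
    (hα0 : 0 < α) (hα1 : α < 1 / L)
    (prox : EuclideanSpace ℝ (Fin n) → EuclideanSpace ℝ (Fin n))
    (hprox : ∀ w z, h (prox w) + (1 / (2 * α)) * ‖prox w - w‖ ^ 2
      ≤ h z + (1 / (2 * α)) * ‖z - w‖ ^ 2)
    (hproxuniq : ∀ w z, (∀ u, h z + (1 / (2 * α)) * ‖z - w‖ ^ 2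
      ≤ h u + (1 / (2 * α)) * ‖u - w‖ ^ 2) → z = prox w)
    (lam : ℕ → Fin m → Fin m → ℝ) (Γ γ : ℝ) (hΓ : 0 < Γ) (hγ0 : 0 < γ) (hγ1 : γ < 1)
    (hlamnn : ∀ k, 2 ≤ k → ∀ i j, 0 ≤ lam k i j)
    (hrow : ∀ k, 2 ≤ k → ∀ i, ∑ j, lam k i j = 1)
    (hcol : ∀ k, 2 ≤ k → ∀ j, ∑ i, lam k i j = 1)
    (hmix : ∀ k, 2 ≤ k → ∀ i j, |lam k i j - 1 / (m : ℝ)| ≤ Γ * γ ^ k)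
    (x q v : ℕ → Fin m → EuclideanSpace ℝ (Fin n))
    (hq : ∀ k, 1 ≤ k → ∀ i, q (k + 1) i = x k i - α • G i (x k i))
    (hv : ∀ k, 1 ≤ k → ∀ i, v (k + 1) i = ∑ j, lam (k + 1) i j • q (k + 1) j)
    (hx : ∀ k, 1 ≤ k → ∀ i, x (k + 1) i = prox (v (k + 1) i))
    (xbar : ℕ → EuclideanSpace ℝ (Fin n))
    (hxbar : ∀ k, xbar k = (m : ℝ)⁻¹ • ∑ i, x k i)
    (vbar zb : ℕ → EuclideanSpace ℝ (Fin n))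
    (hvbar : ∀ k, vbar k = (m : ℝ)⁻¹ • ∑ i, v k i)
    (hzb : ∀ k, zb k = prox (vbar k))
    (gradg : EuclideanSpace ℝ (Fin n) → EuclideanSpace ℝ (Fin n))
    (hgradg : ∀ y, gradg y = (m : ℝ)⁻¹ • ∑ i, G i y)
    (e : ℕ → EuclideanSpace ℝ (Fin n))
    (he : ∀ k, 1 ≤ k → e (k + 1) = (m : ℝ)⁻¹ • ∑ i, (G i (x k i) - G i (xbar k)))
    (eps : ℕ → ℝ)
    (heps : ∀ k, 1 ≤ k → eps (k + 1) =
      ‖xbar (k + 1) - zb (k + 1)‖ * (Gh + α⁻¹ * ‖zb (k + 1) - vbar (k + 1)‖)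
        + (1 / (2 * α)) * ‖xbar (k + 1) - zb (k + 1)‖ ^ 2)
    (gavg f : EuclideanSpace ℝ (Fin n) → ℝ)
    (hgavg : ∀ y, gavg y = (m : ℝ)⁻¹ * ∑ i, g i y)
    (hf : ∀ y, f y = gavg y + h y)
    (xstar : EuclideanSpace ℝ (Fin n))
    (hxstar : ∀ y, f xstar ≤ f y)
    :
    ∃ d : ℕ → EuclideanSpace ℝ (Fin n),
      (∀ k, 1 ≤ k → ∀ u, h (xbar (k + 1)) + ⟪d (k + 1), u - xbar (k + 1)⟫ - eps (k + 1) ≤ h u) ∧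
      Tendsto (fun k : ℕ => ‖gradg (xbar (k + 1)) + d (k + 1)‖) atTop (nhds 0) := by
  have hGg0 : 0 ≤ Gg := (norm_nonneg _).trans (hGg ⟨0, hm⟩ 0)
  have hLα : L < α⁻¹ := by
    rw [lt_div_iff₀ hL] at hα1
    rw [← one_div, lt_div_iff₀ hα0]; linarith
  have hps : ∀ w u, h (prox w) + ⟪α⁻¹ • (w - prox w), u - prox w⟫ ≤ h u := fun w u =>
    subgradient_of_prox hconv (hprox w) u
  have hpK : ∀ w, ‖α⁻¹ • (w - prox w)‖ ≤ Gh := fun w => hsub _ _ (hps w)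
  have hpR : ∀ w, ‖prox w - w‖ ≤ α * Gh := by
    intro w
    have := hpK w
    rw [norm_smul, norm_inv, Real.norm_of_nonneg hα0.le, inv_mul_le_iff₀ hα0] at this
    rwa [norm_sub_rev]
  have hcont : Continuous h := continuousOn_univ.1 (hconv.continuousOn isOpen_univ)
  have hhLip : ∀ y z, h y ≤ h z + Gh * ‖y - z‖ := lipschitz_of_subgradient_bound hconv hcont
    hps hpK hpR
  have hnonexp := nonexpansive_of_subgradient hα0 hps
  have hgavgGrad : ∀ y, HasGradientAt gavg (gradg y) y := by
    intro y
    rw [hgradg, funext hgavg]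
    exact HasGradientAt.average fun i => hgrad i y
  have hgradgK : ∀ y, ‖gradg y‖ ≤ Gg := fun y => by
    rw [hgradg]; exact norm_average_le hm fun i => hGg i y
  have hgradgLip : ∀ y z, ‖gradg y - gradg z‖ ≤ L * ‖y - z‖ := fun y z => by
    rw [hgradg, hgradg, ← average_sub_average]
    exact norm_average_le hm fun i => hLip i y z
  -- linear growth of the iterates
  let A : ℝ := ∑ i, ‖x 1 i‖
  let B : ℝ := α * (Gg + Gh)
  have hA0 : 0 ≤ A := Finset.sum_nonneg fun i _ => norm_nonneg _
  have hB0 : 0 ≤ B := by positivity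
  have hqx : ∀ k i, ‖q (k + 2) i‖ ≤ ‖x (k + 1) i‖ + α * Gg := by
    intro k i
    rw [hq (k + 1) (by omega) i]
    refine (norm_sub_le _ _).trans (add_le_add le_rfl ?_)
    rw [norm_smul, Real.norm_of_nonneg hα0.le]
    exact mul_le_mul_of_nonneg_left (hGg _ _) hα0.le
  have hxgrow : ∀ k i, ‖x (k + 1) i‖ ≤ A + k * B := by
    intro k
    induction k with
    | zero =>
      intro i
      simpa using Finset.single_le_sum (f := fun i => ‖x 1 i‖) (fun j _ => norm_nonneg _)
        (Finset.mem_univ i)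
    | succ k ih =>
      intro i
      have hvi : ‖v (k + 2) i‖ ≤ A + k * B + α * Gg := by
        rw [hv (k + 1) (by omega) i]
        calc ‖∑ j, lam (k + 2) i j • q (k + 2) j‖
            ≤ ∑ j, lam (k + 2) i j * (A + k * B + α * Gg) := by
              refine norm_sum_le_of_le _ fun j _ => ?_
              rw [norm_smul, Real.norm_of_nonneg (hlamnn _ (by omega) i j)]
              exact mul_le_mul_of_nonneg_left ((hqx k j).trans (by linarith [ih j]))
                (hlamnn _ (by omega) i j)
          _ = A + k * B + α * Gg := by
              rw [← Finset.sum_mul, hrow _ (by omega) i, one_mul]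
      rw [hx (k + 1) (by omega) i]
      have h1 := norm_add_le (prox (v (k + 2) i) - v (k + 2) i) (v (k + 2) i)
      rw [sub_add_cancel] at h1
      have h2 := hpR (v (k + 2) i)
      push_cast
      have h3 : ((k : ℝ) + 1) * B = k * B + α * Gg + α * Gh := by simp only [B]; ring
      change ‖prox (v (k + 2) i)‖ ≤ _
      linarith
  -- the consensus error is summable
  let δ : ℕ → ℝ := fun k => Γ * γ ^ (k + 2) * (m * (A + k * B + α * Gg))
  have hδ0 : ∀ k, 0 ≤ δ k := fun k => by positivity
  have hδsum : Summable δ := by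
    have hγn : ‖γ‖ < 1 := by rwa [Real.norm_of_nonneg hγ0.le]
    have h1 := (summable_pow_mul_geometric_of_norm_lt_one 1 hγn).mul_left (Γ * γ ^ 2 * m * B)
    have h2 := (summable_geometric_of_norm_lt_one hγn).mul_left (Γ * γ ^ 2 * m * (A + α * Gg))
    refine (h1.add h2).congr fun k => ?_
    simp only [δ]; ring
  have hvbarq : ∀ k, vbar (k + 2) = (m : ℝ)⁻¹ • ∑ j, q (k + 2) j := by
    intro k
    rw [hvbar, Finset.sum_congr rfl fun i _ => hv (k + 1) (by omega) i, Finset.sum_comm]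
    congr 1
    refine Finset.sum_congr rfl fun j _ => ?_
    rw [← Finset.sum_smul, hcol _ (by omega) j, one_smul]
  have hvcons : ∀ k i, ‖v (k + 2) i - vbar (k + 2)‖ ≤ δ k := by
    intro k i
    rw [hvbarq, hv (k + 1) (by omega) i, Finset.smul_sum, ← Finset.sum_sub_distrib]
    calc ‖∑ j, (lam (k + 2) i j • q (k + 2) j - (m : ℝ)⁻¹ • q (k + 2) j)‖
        ≤ ∑ _j : Fin m, Γ * γ ^ (k + 2) * (A + k * B + α * Gg) := by
          refine norm_sum_le_of_le _ fun j _ => ?_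
          rw [← sub_smul, norm_smul, Real.norm_eq_abs, ← one_div]
          exact mul_le_mul (hmix _ (by omega) i j) ((hqx k j).trans (by linarith [hxgrow k j]))
            (norm_nonneg _) (by positivity)
      _ = δ k := by simp [δ]; ring
  have hxz : ∀ k i, ‖x (k + 2) i - zb (k + 2)‖ ≤ δ k := fun k i => by
    rw [hx (k + 1) (by omega) i, hzb]
    exact (hnonexp _ _).trans (hvcons k i)
  have hxbz : ∀ k, ‖xbar (k + 2) - zb (k + 2)‖ ≤ δ k := fun k => by
    rw [hxbar, ← average_sub_const hm]
    exact norm_average_le hm (hxz k)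
  have he_le : ∀ k, ‖e (k + 3)‖ ≤ 2 * L * δ k := by
    intro k
    rw [he (k + 2) (by omega)]
    refine norm_average_le hm fun i => (hLip i _ _).trans ?_
    have h1 := norm_sub_le_norm_sub_add_norm_sub (x (k + 2) i) (zb (k + 2)) (xbar (k + 2))
    rw [norm_sub_rev (zb (k + 2))] at h1
    nlinarith [hxz k i, hxbz k]
  have hvb : ∀ k, vbar (k + 3) = xbar (k + 2) - α • (gradg (xbar (k + 2)) + e (k + 3)) := by
    intro k
    rw [hvbarq (k + 1), Finset.sum_congr rfl fun i _ => hq (k + 2) (by omega) i,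
      he (k + 2) (by omega), average_sub_average, average_sub_average, ← hgradg, add_sub_cancel,
      ← hxbar, ← Finset.smul_sum, smul_comm]
  let d : ℕ → EuclideanSpace ℝ (Fin n) := fun k => α⁻¹ • (vbar k - zb k)
  have hdK : ∀ k, ‖d k‖ ≤ Gh := fun k => by simp only [d]; rw [hzb]; exact hpK _
  have hdsub : ∀ k u, h (zb k) + ⟪d k, u - zb k⟫ ≤ h u := fun k u => by
    simp only [d]; rw [hzb]; exact hps _ _
  have hd : ∀ k, d (k + 3) =
      α⁻¹ • (xbar (k + 2) - zb (k + 3)) - gradg (xbar (k + 2)) - e (k + 3) := by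
    intro k
    simp only [d]
    rw [hvb, sub_right_comm, smul_sub α⁻¹ (xbar (k + 2) - zb (k + 3)), smul_smul,
      inv_mul_cancel₀ hα0.ne', one_smul]
    abel
  -- descent along the averaged iterates
  let r : ℕ → ℝ := fun k => ‖zb (k + 3) - xbar (k + 2)‖
  let c : ℕ → ℝ := fun k => 2 * L * (α * (Gh + 3 * Gg)) * δ k + (Gg + Gh) * δ (k + 1)
  have hc0 : ∀ k, 0 ≤ c k := fun k => by
    have := hδ0 k
    have := hδ0 (k + 1)
    positivity
  have hδsum' : Summable fun k => δ (k + 1) := (summable_nat_add_iff 1).2 hδsum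
  have hcsum : Summable c := (hδsum.mul_left _).add (hδsum'.mul_left _)
  have hr_le : ∀ k, r k ≤ α * (Gh + 3 * Gg) := by
    intro k
    have heG : ‖e (k + 3)‖ ≤ 2 * Gg := by
      rw [he (k + 2) (by omega)]
      exact norm_average_le hm fun i => (norm_sub_le _ _).trans (by
        linarith [hGg i (x (k + 2) i), hGg i (xbar (k + 2))])
    have h1 : xbar (k + 2) - zb (k + 3)
        = α • (d (k + 3) + gradg (xbar (k + 2)) + e (k + 3)) := by
      rw [hd, add_assoc, sub_sub, sub_add_cancel, smul_smul, mul_inv_cancel₀ hα0.ne', one_smul]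
    change ‖zb (k + 3) - xbar (k + 2)‖ ≤ _
    rw [norm_sub_rev, h1, norm_smul, Real.norm_of_nonneg hα0.le]
    refine mul_le_mul_of_nonneg_left ((norm_add₃_le).trans ?_) hα0.le
    linarith [hdK (k + 3), hgradgK (xbar (k + 2))]
  have hstep : ∀ k, f (xbar (k + 3)) ≤ f (xbar (k + 2)) - α⁻¹ / 2 * r k ^ 2 + c k := by
    intro k
    have h1 := descent_of_lipschitz_gradient hgavgGrad hgradgLip (xbar (k + 2)) (zb (k + 3))
    have h2 := hdsub (k + 3) (xbar (k + 2))
    have h3 : ⟪d (k + 3), xbar (k + 2) - zb (k + 3)⟫ = α⁻¹ * r k ^ 2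
        + ⟪gradg (xbar (k + 2)), zb (k + 3) - xbar (k + 2)⟫
        + ⟪e (k + 3), zb (k + 3) - xbar (k + 2)⟫ := by
      rw [hd, ← neg_sub (zb (k + 3)) (xbar (k + 2)), inner_sub_left, inner_sub_left,
        real_inner_smul_left, inner_neg_neg, real_inner_self_eq_norm_sq, inner_neg_right,
        inner_neg_right]
      ring
    have h4 : -⟪e (k + 3), zb (k + 3) - xbar (k + 2)⟫ ≤ 2 * L * δ k * (α * (Gh + 3 * Gg)) :=
      (neg_le_abs _).trans ((abs_real_inner_le_norm _ _).trans
        (mul_le_mul (he_le k) (hr_le k) (norm_nonneg _) ((norm_nonneg _).trans (he_le k))))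
    have h5 := hhLip (xbar (k + 3)) (zb (k + 3))
    have h6 := le_of_abs_le
      (abs_sub_le_of_gradient_bound hgavgGrad hgradgK (zb (k + 3)) (xbar (k + 3)))
    have h7 := mul_le_mul_of_nonneg_left (hxbz (k + 1)) (add_nonneg hGg0 hGh.le)
    have h8 := mul_nonneg (sub_nonneg.2 hLα.le) (sq_nonneg (r k))
    rw [hf, hf]
    change gavg (zb (k + 3)) ≤ _ + _ + L / 2 * r k ^ 2 at h1
    change (Gg + Gh) * ‖xbar (k + 3) - zb (k + 3)‖ ≤ _ at h7
    simp only [c]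
    linarith
  have hr2 : Tendsto (fun k => α⁻¹ / 2 * r k ^ 2) atTop (nhds 0) :=
    tendsto_zero_of_quasi_descent (a := fun k => f (xbar (k + 2))) (fun k => hxstar _)
      (fun k => by positivity) hc0 hcsum hstep
  have hr : Tendsto r atTop (nhds 0) := by
    have h1 := (hr2.const_mul (2 * α)).sqrt
    rw [mul_zero, Real.sqrt_zero] at h1
    refine h1.congr fun k => ?_
    rw [show 2 * α * (α⁻¹ / 2 * r k ^ 2) = r k ^ 2 by field_simp]
    exact Real.sqrt_sq (norm_nonneg _)
  refine ⟨d, fun k hk u => ?_, ?_⟩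
  · have h1 := hdsub (k + 1) u
    have h2 := hhLip (xbar (k + 1)) (zb (k + 1))
    have h3 : ⟪d (k + 1), u - zb (k + 1)⟫
        = ⟪d (k + 1), u - xbar (k + 1)⟫ + ⟪d (k + 1), xbar (k + 1) - zb (k + 1)⟫ := by
      rw [← inner_add_right, sub_add_sub_cancel]
    have h4 := neg_le_of_abs_le (abs_real_inner_le_norm (d (k + 1)) (xbar (k + 1) - zb (k + 1)))
    have h5 : ‖d (k + 1)‖ = α⁻¹ * ‖zb (k + 1) - vbar (k + 1)‖ := by
      simp only [d]
      rw [norm_smul, norm_inv, Real.norm_of_nonneg hα0.le, norm_sub_rev]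
    have h6 : 0 ≤ (1 / (2 * α)) * ‖xbar (k + 1) - zb (k + 1)‖ ^ 2 := by positivity
    rw [h5] at h4
    rw [heps k hk]
    linarith
  · rw [← tendsto_add_atTop_iff_nat 2]
    have hlim : Tendsto (fun k => (L + α⁻¹) * r k + L * δ (k + 1) + 2 * L * δ k) atTop
        (nhds 0) := by
      simpa using ((hr.const_mul (L + α⁻¹)).add (hδsum'.tendsto_atTop_zero.const_mul L)).add
        (hδsum.tendsto_atTop_zero.const_mul (2 * L))
    refine squeeze_zero (fun k => norm_nonneg _) (fun k => ?_) hlim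
    change ‖gradg (xbar (k + 3)) + d (k + 3)‖ ≤ _
    have h1 : gradg (xbar (k + 3)) + d (k + 3) = (gradg (xbar (k + 3)) - gradg (xbar (k + 2)))
        + α⁻¹ • (xbar (k + 2) - zb (k + 3)) - e (k + 3) := by
      rw [hd]; abel
    have h2 := norm_sub_le ((gradg (xbar (k + 3)) - gradg (xbar (k + 2)))
        + α⁻¹ • (xbar (k + 2) - zb (k + 3))) (e (k + 3))
    have h3 := norm_add_le (gradg (xbar (k + 3)) - gradg (xbar (k + 2)))
      (α⁻¹ • (xbar (k + 2) - zb (k + 3)))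
    have h4 := hgradgLip (xbar (k + 3)) (xbar (k + 2))
    have h5 : ‖xbar (k + 3) - xbar (k + 2)‖ ≤ δ (k + 1) + r k :=
      (norm_sub_le_norm_sub_add_norm_sub _ (zb (k + 3)) _).trans
        (add_le_add (hxbz (k + 1)) le_rfl)
    have h6 := mul_le_mul_of_nonneg_left h5 hL.le
    have h7 : ‖α⁻¹ • (xbar (k + 2) - zb (k + 3))‖ = α⁻¹ * r k := by
      rw [norm_smul, norm_inv, Real.norm_of_nonneg hα0.le, norm_sub_rev]
    rw [h1]
    linarith [he_le k]
end

section
/- For every k ≥ 1, the averaged iterates of the distributed proximal gradient algorithm satisfy the descent inequality f(x̄_{k+1}) ≤ f(x̄_k) − (1/α − L/2) ‖x̄_{k+1} − x̄_k‖² + (‖e_{k+1}‖ + √(2 ε_{k+1} / α)) ‖x̄_{k+1} − x̄_k‖ + ε_{k+1}. -/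
open scoped RealInnerProductSpace
open Filter

section ProxDescent

variable {E : Type*} [NormedAddCommGroup E] [InnerProductSpace ℝ E]

/-- The quadratic upper bound for a function with Lipschitz gradient. -/
theorem le_quadratic_of_lipschitz_gradient [CompleteSpace E] {g : E → ℝ} {G : E → E} {L : ℝ}
    (hgrad : ∀ x, HasGradientAt g (G x) x) (hLip : ∀ x y, ‖G x - G y‖ ≤ L * ‖x - y‖) (x y : E) :
    g x ≤ g y + ⟪G y, x - y⟫ + L / 2 * ‖x - y‖ ^ 2 := by
  set φ : ℝ → ℝ := fun t => g (y + t • (x - y)) - t * ⟪G y, x - y⟫ - L / 2 * ‖x - y‖ ^ 2 * t ^ 2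
    with hφ
  have hderiv : ∀ t, HasDerivAt φ
      (⟪G (y + t • (x - y)), x - y⟫ - ⟪G y, x - y⟫ - L * ‖x - y‖ ^ 2 * t) t := by
    intro t
    have hline : HasDerivAt (fun t : ℝ => y + t • (x - y)) (x - y) t := by
      simpa using ((hasDerivAt_id t).smul_const (x - y)).const_add y
    have hcomp := (hgrad (y + t • (x - y))).hasFDerivAt.comp_hasDerivAt t hline
    have hlin := (hasDerivAt_id t).mul_const ⟪G y, x - y⟫
    have hquad := (hasDerivAt_pow 2 t).const_mul (L / 2 * ‖x - y‖ ^ 2)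
    refine ((hcomp.sub hlin).sub hquad).congr_deriv ?_
    simp
    ring
  have hanti : AntitoneOn φ (Set.Icc 0 1) := by
    refine antitoneOn_of_deriv_nonpos (convex_Icc 0 1)
      (fun t _ => (hderiv t).continuousAt.continuousWithinAt)
      (fun t _ => (hderiv t).differentiableAt.differentiableWithinAt) fun t ht => ?_
    rw [interior_Icc] at ht
    rw [(hderiv t).deriv, ← inner_sub_left]
    have hG := hLip (y + t • (x - y)) y
    rw [add_sub_cancel_left, norm_smul, Real.norm_of_nonneg ht.1.le] at hG
    have hCS := real_inner_le_norm (G (y + t • (x - y)) - G y) (x - y)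
    nlinarith [mul_le_mul_of_nonneg_right hG (norm_nonneg (x - y))]
  have hle := hanti (Set.left_mem_Icc.2 zero_le_one) (Set.right_mem_Icc.2 zero_le_one) zero_le_one
  simp [hφ] at hle
  linarith

/-- An `ε`-minimizer of the proximal objective satisfies an approximate subgradient inequality. -/
theorem approx_subgradient_of_approx_prox {h : E → ℝ} (hconv : ConvexOn ℝ Set.univ h)
    {α ε : ℝ} (hα : 0 < α) (hε : 0 ≤ ε) {v x : E}
    (hmin : ∀ u, h x + 1 / (2 * α) * ‖x - v‖ ^ 2 ≤ h u + 1 / (2 * α) * ‖u - v‖ ^ 2 + ε) (y : E) :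
    h x + 1 / α * ⟪v - x, y - x⟫ ≤ h y + √(2 * ε / α) * ‖y - x‖ + ε := by
  set D := ‖y - x‖ with hD
  set r := h y - h x - 1 / α * ⟪v - x, y - x⟫ with hr
  have hseg : ∀ t : ℝ, 0 ≤ t → t ≤ 1 → 0 ≤ t * r + t ^ 2 * (D ^ 2 / (2 * α)) + ε := by
    intro t ht0 ht1
    have hc := hconv.2 (Set.mem_univ x) (Set.mem_univ y) (sub_nonneg.2 ht1) ht0 (by ring)
    have hm := hmin ((1 - t) • x + t • y)
    have hn : ‖(1 - t) • x + t • y - v‖ ^ 2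
        = ‖x - v‖ ^ 2 - 2 * t * ⟪v - x, y - x⟫ + t ^ 2 * D ^ 2 := by
      rw [show (1 - t) • x + t • y - v = (x - v) + t • (y - x) by module, norm_add_sq_real,
        norm_smul, mul_pow, Real.norm_eq_abs, sq_abs, inner_smul_right, ← neg_sub v x,
        inner_neg_left]
      ring
    rw [hn] at hm
    simp only [smul_eq_mul] at hc
    have he : 1 / (2 * α) * (‖x - v‖ ^ 2 - 2 * t * ⟪v - x, y - x⟫ + t ^ 2 * D ^ 2)
        = 1 / (2 * α) * ‖x - v‖ ^ 2 - t * (1 / α * ⟪v - x, y - x⟫)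
          + t ^ 2 * (D ^ 2 / (2 * α)) := by
      field_simp
    rw [he] at hm
    rw [hr]
    linarith
  set s := √(2 * ε / α) with hs
  have hs0 : 0 ≤ s := Real.sqrt_nonneg _
  have hs2 : s ^ 2 = 2 * ε / α := Real.sq_sqrt (by positivity)
  have hεs : ε = α * s ^ 2 / 2 := by rw [hs2]; field_simp
  have hD0 : 0 ≤ D := norm_nonneg _
  suffices 0 ≤ r + s * D + ε by rw [hr] at this; linarith
  rcases le_or_gt D (α * s) with hcase | hcase
  · have h1 := hseg 1 zero_le_one le_rfl
    have h2 : D ^ 2 / (2 * α) ≤ s * D := by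
      rw [div_le_iff₀ (by positivity)]
      nlinarith [mul_le_mul_of_nonneg_right hcase hD0, mul_nonneg (mul_nonneg hα.le hs0) hD0]
    linarith
  · have hDpos : 0 < D := lt_of_le_of_lt (by positivity) hcase
    rcases hs0.eq_or_lt with hzero | hspos
    · rw [← hzero] at hεs ⊢
      have hε0 : ε = 0 := by simpa using hεs
      by_contra! hneg
      have hr0 : r < 0 := by linarith
      set B := D ^ 2 / (2 * α)
      have hB : 0 < B := by positivity
      have hden : 0 < B - r := by linarith
      have ht := hseg (-r / (2 * (B - r))) (div_nonneg (by linarith) (by linarith))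
        (by rw [div_le_one (by linarith)]; linarith)
      have : -r / (2 * (B - r)) * r + (-r / (2 * (B - r))) ^ 2 * B + ε
          = -(r ^ 2 * (B - 2 * r)) / (4 * (B - r) ^ 2) := by
        rw [hε0]; field_simp; ring
      rw [this] at ht
      have : 0 < (r ^ 2 * (B - 2 * r)) / (4 * (B - r) ^ 2) := by
        apply div_pos (mul_pos (sq_pos_of_neg hr0) (by linarith)) (by positivity)
      rw [neg_div] at ht
      linarith
    · have ht := hseg (α * s / D) (by positivity) (by rw [div_le_one hDpos]; exact hcase.le)
      have heq : α * s / D * r + (α * s / D) ^ 2 * (D ^ 2 / (2 * α)) + ε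
          = α * s / D * (r + s * D) := by
        rw [hεs]; field_simp; ring
      rw [heq] at ht
      have := nonneg_of_mul_nonneg_right ht (by positivity)
      linarith

/-- A continuous convex function with uniformly bounded slopes at points that come within a
bounded distance of every point is Lipschitz. -/
theorem ConvexOn.le_add_mul_norm_of_coarsely_dense {h : E → ℝ} (hconv : ConvexOn ℝ Set.univ h)
    (hcont : Continuous h) {K C : ℝ} (hK : 0 ≤ K)
    (hdense : ∀ w, ∃ p, ‖p - w‖ ≤ C ∧ ∀ u, h p ≤ h u + K * ‖p - u‖) (x z : E) :
    h x ≤ h z + K * ‖x - z‖ := by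
  choose p hpC hp using hdense
  set w : ℕ → E := fun k => z + ((k : ℝ) + 2) • (x - z)
  set a : ℕ → E := fun k => z - (1 / ((k : ℝ) + 1)) • (p (w k) - w k)
  have hτ : Tendsto (fun k : ℕ => 1 / ((k : ℝ) + 1)) atTop (nhds 0) :=
    tendsto_one_div_add_atTop_nhds_zero_nat
  have hσ : Tendsto (fun k : ℕ => 1 / ((k : ℝ) + 2)) atTop (nhds 0) := by
    have := hτ.comp (tendsto_add_atTop_nat 1)
    refine this.congr fun k => ?_
    simp only [Function.comp_apply]
    push_cast
    ring
  have ha : Tendsto a atTop (nhds z) := by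
    have hsmall : Tendsto (fun k : ℕ => (1 / ((k : ℝ) + 1)) • (p (w k) - w k)) atTop (nhds 0) := by
      refine squeeze_zero_norm (fun k => ?_)
        (show Tendsto _ _ (nhds 0) by simpa only [zero_mul] using hτ.mul_const C)
      rw [norm_smul, Real.norm_of_nonneg (by positivity)]
      exact mul_le_mul_of_nonneg_left (hpC _) (by positivity)
    simpa only [sub_zero] using (tendsto_const_nhds (x := z)).sub hsmall
  have hbound : ∀ k : ℕ, h x ≤ (1 - 1 / ((k : ℝ) + 2)) * h (a k)
      + 1 / ((k : ℝ) + 2) * (h z + K * C) + K * ‖x - z‖ := by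
    intro k
    have hk1 : (0 : ℝ) < k + 1 := by positivity
    have hk2 : (0 : ℝ) < k + 2 := by positivity
    have hcomb : x = (1 - 1 / ((k : ℝ) + 2)) • a k + (1 / ((k : ℝ) + 2)) • p (w k) := by
      simp only [a, w]
      match_scalars <;> field_simp <;> ring
    have hc := hconv.2 (Set.mem_univ (a k)) (Set.mem_univ (p (w k)))
      (show 0 ≤ 1 - 1 / ((k : ℝ) + 2) by
        rw [sub_nonneg, div_le_one hk2]; linarith)
      (show 0 ≤ 1 / ((k : ℝ) + 2) by positivity) (by ring)
    rw [← hcomb] at hc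
    simp only [smul_eq_mul] at hc
    have hdist : ‖p (w k) - z‖ ≤ C + (k + 2) * ‖x - z‖ := by
      calc ‖p (w k) - z‖ = ‖(p (w k) - w k) + ((k : ℝ) + 2) • (x - z)‖ := by
            congr 1; simp only [w]; abel
        _ ≤ _ := (norm_add_le _ _).trans (by
            rw [norm_smul, Real.norm_of_nonneg hk2.le]
            exact add_le_add_left (hpC _) _)
    have hpz : h (p (w k)) ≤ h z + K * (C + (k + 2) * ‖x - z‖) :=
      (hp (w k) z).trans (by gcongr)
    have hlast := mul_le_mul_of_nonneg_left hpz (show 0 ≤ 1 / ((k : ℝ) + 2) by positivity)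
    have hexp : 1 / ((k : ℝ) + 2) * (h z + K * (C + (k + 2) * ‖x - z‖))
        = 1 / ((k : ℝ) + 2) * (h z + K * C) + K * ‖x - z‖ := by
      field_simp
      ring
    linarith
  have hlim : Tendsto (fun k : ℕ => (1 - 1 / ((k : ℝ) + 2)) * h (a k)
      + 1 / ((k : ℝ) + 2) * (h z + K * C) + K * ‖x - z‖) atTop
      (nhds ((1 - 0) * h z + 0 * (h z + K * C) + K * ‖x - z‖)) :=
    (((tendsto_const_nhds.sub hσ).mul ((hcont.tendsto z).comp ha)).add
      (hσ.mul_const _)).add_const _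
  simpa using ge_of_tendsto' hlim hbound

/-- A convex function whose subgradients are bounded by `K` and which admits a proximal point at
every point is `K`-Lipschitz. -/
theorem ConvexOn.le_add_mul_norm_of_subgradient_bound {h : E → ℝ}
    (hconv : ConvexOn ℝ Set.univ h) (hcont : Continuous h) {K α : ℝ} (hK : 0 ≤ K) (hα : 0 < α)
    (hsub : ∀ x z : E, (∀ u, h x + ⟪z, u - x⟫ ≤ h u) → ‖z‖ ≤ K) {prox : E → E}
    (hprox : ∀ w z, h (prox w) + (1 / (2 * α)) * ‖prox w - w‖ ^ 2
      ≤ h z + (1 / (2 * α)) * ‖z - w‖ ^ 2) (x z : E) :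
    h x ≤ h z + K * ‖x - z‖ := by
  have hsubgrad : ∀ w u, h (prox w) + ⟪(1 / α) • (w - prox w), u - prox w⟫ ≤ h u := by
    intro w u
    have := approx_subgradient_of_approx_prox hconv hα le_rfl
      (fun u => by simpa using hprox w u) u
    simpa [real_inner_smul_left] using this
  have hbound : ∀ w, ‖(1 / α) • (w - prox w)‖ ≤ K := fun w => hsub _ _ (hsubgrad w)
  refine hconv.le_add_mul_norm_of_coarsely_dense hcont hK (C := α * K)
    (fun w => ⟨prox w, ?_, fun u => ?_⟩) x z
  · have := hbound w
    rwa [norm_smul, Real.norm_of_nonneg (by positivity), one_div, inv_mul_le_iff₀ hα,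
      norm_sub_rev] at this
  · have h1 := hsubgrad w u
    have h2 := real_inner_le_norm (-((1 / α) • (w - prox w))) (u - prox w)
    rw [inner_neg_left, norm_neg, norm_sub_rev u] at h2
    have h3 := mul_le_mul_of_nonneg_right (hbound w) (norm_nonneg (prox w - u))
    linarith

/-- A point near an exact proximal point is an approximate minimizer of the proximal objective. -/
theorem approx_prox_of_lipschitz {h : E → ℝ} {K α : ℝ} (hα : 0 < α)
    (hlip : ∀ x z, h x ≤ h z + K * ‖x - z‖) {v z : E}
    (hz : ∀ u, h z + 1 / (2 * α) * ‖z - v‖ ^ 2 ≤ h u + 1 / (2 * α) * ‖u - v‖ ^ 2) (x u : E) :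
    h x + 1 / (2 * α) * ‖x - v‖ ^ 2 ≤ h u + 1 / (2 * α) * ‖u - v‖ ^ 2
      + (‖x - z‖ * (K + α⁻¹ * ‖z - v‖) + 1 / (2 * α) * ‖x - z‖ ^ 2) := by
  have hsq : ‖x - v‖ ^ 2 ≤ ‖x - z‖ ^ 2 + 2 * (‖x - z‖ * ‖z - v‖) + ‖z - v‖ ^ 2 := by
    rw [← sub_add_sub_cancel x z v, norm_add_sq_real]
    linarith [real_inner_le_norm (x - z) (z - v)]
  have hmul := mul_le_mul_of_nonneg_left hsq (show 0 ≤ 1 / (2 * α) by positivity)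
  have hexp : 1 / (2 * α) * (‖x - z‖ ^ 2 + 2 * (‖x - z‖ * ‖z - v‖) + ‖z - v‖ ^ 2)
      = 1 / (2 * α) * ‖x - z‖ ^ 2 + ‖x - z‖ * (α⁻¹ * ‖z - v‖) + 1 / (2 * α) * ‖z - v‖ ^ 2 := by
    field_simp
  linarith [hz u, hlip x z]

/-- Column-stochastic mixing preserves the sum. -/
theorem sum_mix_eq_sum {ι : Type*} [Fintype ι] {lam : ι → ι → ℝ} (hcol : ∀ j, ∑ i, lam i j = 1)
    (q : ι → E) : ∑ i, ∑ j, lam i j • q j = ∑ j, q j := by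
  rw [Finset.sum_comm]
  simp [← Finset.sum_smul, hcol]

end ProxDescent

theorem stmt_18
    (n m : ℕ) (hn : 0 < n) (hm : 1 ≤ m)
    (g : Fin m → EuclideanSpace ℝ (Fin n) → ℝ)
    (G : Fin m → EuclideanSpace ℝ (Fin n) → EuclideanSpace ℝ (Fin n))
    (L Gg Gh α : ℝ) (hL : 0 < L)
    (hgrad : ∀ i x, HasGradientAt (g i) (G i x) x)
    (hLip : ∀ i x y, ‖G i x - G i y‖ ≤ L * ‖x - y‖)
    (hGg : ∀ i x, ‖G i x‖ ≤ Gg)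
    (h : EuclideanSpace ℝ (Fin n) → ℝ)
    (hconv : ConvexOn ℝ Set.univ h)
    (hGh : 0 < Gh)
    (hsub : ∀ x z : EuclideanSpace ℝ (Fin n), (∀ u, h x + ⟪z, u - x⟫ ≤ h u) → ‖z‖ ≤ Gh)
    (hα0 : 0 < α) (hα1 : α < 1 / L)
    (prox : EuclideanSpace ℝ (Fin n) → EuclideanSpace ℝ (Fin n))
    (hprox : ∀ w z, h (prox w) + (1 / (2 * α)) * ‖prox w - w‖ ^ 2
      ≤ h z + (1 / (2 * α)) * ‖z - w‖ ^ 2)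
    (hproxuniq : ∀ w z, (∀ u, h z + (1 / (2 * α)) * ‖z - w‖ ^ 2
      ≤ h u + (1 / (2 * α)) * ‖u - w‖ ^ 2) → z = prox w)
    (lam : ℕ → Fin m → Fin m → ℝ) (Γ γ : ℝ) (hΓ : 0 < Γ) (hγ0 : 0 < γ) (hγ1 : γ < 1)
    (hlamnn : ∀ k, 2 ≤ k → ∀ i j, 0 ≤ lam k i j)
    (hrow : ∀ k, 2 ≤ k → ∀ i, ∑ j, lam k i j = 1)
    (hcol : ∀ k, 2 ≤ k → ∀ j, ∑ i, lam k i j = 1)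
    (hmix : ∀ k, 2 ≤ k → ∀ i j, |lam k i j - 1 / (m : ℝ)| ≤ Γ * γ ^ k)
    (x q v : ℕ → Fin m → EuclideanSpace ℝ (Fin n))
    (hq : ∀ k, 1 ≤ k → ∀ i, q (k + 1) i = x k i - α • G i (x k i))
    (hv : ∀ k, 1 ≤ k → ∀ i, v (k + 1) i = ∑ j, lam (k + 1) i j • q (k + 1) j)
    (hx : ∀ k, 1 ≤ k → ∀ i, x (k + 1) i = prox (v (k + 1) i))
    (xbar : ℕ → EuclideanSpace ℝ (Fin n))
    (hxbar : ∀ k, xbar k = (m : ℝ)⁻¹ • ∑ i, x k i)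
    (vbar zb : ℕ → EuclideanSpace ℝ (Fin n))
    (hvbar : ∀ k, vbar k = (m : ℝ)⁻¹ • ∑ i, v k i)
    (hzb : ∀ k, zb k = prox (vbar k))
    (gradg : EuclideanSpace ℝ (Fin n) → EuclideanSpace ℝ (Fin n))
    (hgradg : ∀ y, gradg y = (m : ℝ)⁻¹ • ∑ i, G i y)
    (e : ℕ → EuclideanSpace ℝ (Fin n))
    (he : ∀ k, 1 ≤ k → e (k + 1) = (m : ℝ)⁻¹ • ∑ i, (G i (x k i) - G i (xbar k)))
    (eps : ℕ → ℝ)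
    (heps : ∀ k, 1 ≤ k → eps (k + 1) =
      ‖xbar (k + 1) - zb (k + 1)‖ * (Gh + α⁻¹ * ‖zb (k + 1) - vbar (k + 1)‖)
        + (1 / (2 * α)) * ‖xbar (k + 1) - zb (k + 1)‖ ^ 2)
    (gavg f : EuclideanSpace ℝ (Fin n) → ℝ)
    (hgavg : ∀ y, gavg y = (m : ℝ)⁻¹ * ∑ i, g i y)
    (hf : ∀ y, f y = gavg y + h y)
    :
    ∀ k, 1 ≤ k →
      f (xbar (k + 1)) ≤ f (xbar k)
        - (1 / α - L / 2) * ‖xbar (k + 1) - xbar k‖ ^ 2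
        + (‖e (k + 1)‖ + Real.sqrt (2 * eps (k + 1) / α)) * ‖xbar (k + 1) - xbar k‖
        + eps (k + 1) := by
  intro k hk
  have hm0 : (m : ℝ) ≠ 0 := by positivity
  have hcont : Continuous h := by
    have := hconv.continuousOn isOpen_univ
    rwa [continuousOn_univ] at this
  have hlip := hconv.le_add_mul_norm_of_subgradient_bound hcont hGh.le hα0 hsub hprox
  have hg : gavg (xbar (k + 1)) ≤ gavg (xbar k)
      + ⟪gradg (xbar k), xbar (k + 1) - xbar k⟫ + L / 2 * ‖xbar (k + 1) - xbar k‖ ^ 2 := by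
    have hsum := Finset.sum_le_sum fun i (_ : i ∈ Finset.univ) =>
      le_quadratic_of_lipschitz_gradient (hgrad i) (hLip i) (xbar (k + 1)) (xbar k)
    simp only [Finset.sum_add_distrib, Finset.sum_const, Finset.card_univ, Fintype.card_fin,
      nsmul_eq_mul] at hsum
    rw [hgavg, hgavg, hgradg, real_inner_smul_left, sum_inner]
    have hmul := mul_le_mul_of_nonneg_left hsum (show 0 ≤ (m : ℝ)⁻¹ by positivity)
    rwa [mul_add, mul_add, inv_mul_cancel_left₀ hm0] at hmul
  have hvb : vbar (k + 1) = xbar k - α • (gradg (xbar k) + e (k + 1)) := by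
    rw [hvbar, Finset.sum_congr rfl fun i _ => hv k hk i,
      sum_mix_eq_sum (hcol (k + 1) (by omega)), Finset.sum_congr rfl fun i _ => hq k hk i,
      he k hk, hgradg, hxbar k, Finset.sum_sub_distrib, Finset.sum_sub_distrib,
      ← Finset.smul_sum]
    module
  have hε : 0 ≤ eps (k + 1) := by
    rw [heps k hk]
    positivity
  have hh := approx_subgradient_of_approx_prox hconv hα0 hε (v := vbar (k + 1))
    (x := xbar (k + 1)) (fun u => by
      rw [heps k hk, hzb]
      exact approx_prox_of_lipschitz hα0 hlip (hprox _) _ u) (xbar k)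
  have hinner : 1 / α * ⟪vbar (k + 1) - xbar (k + 1), xbar k - xbar (k + 1)⟫
      = 1 / α * ‖xbar (k + 1) - xbar k‖ ^ 2 + ⟪gradg (xbar k), xbar (k + 1) - xbar k⟫
        + ⟪e (k + 1), xbar (k + 1) - xbar k⟫ := by
    rw [hvb, show xbar k - α • (gradg (xbar k) + e (k + 1)) - xbar (k + 1)
        = -((xbar (k + 1) - xbar k) + α • (gradg (xbar k) + e (k + 1))) by abel,
      ← neg_sub (xbar (k + 1)) (xbar k), inner_neg_neg, inner_add_left, real_inner_smul_left,
      inner_add_left, real_inner_self_eq_norm_sq]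
    field_simp
    ring
  rw [hinner, norm_sub_rev (xbar k)] at hh
  have hCS := neg_le_of_abs_le (abs_real_inner_le_norm (e (k + 1)) (xbar (k + 1) - xbar k))
  rw [hf, hf]
  linarith
end

section
/- The distributed proximal gradient algorithm converges at rate O(1/T): there exists a constant C ≥ 0, independent of T, such that for every T ≥ 2, ∑_{k=2}^T ‖x̄_k − x̄_{k−1}‖² ≤ C; equivalently, (1/T) ∑_{k=2}^T ‖x̄_k − x̄_{k−1}‖² ≤ C/T for every T ≥ 2, where x̄_k = (1/m)∑_{i=1}^m x_{i,k}. -/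
open scoped RealInnerProductSpace
open Filter

section ProximalGradient

variable {E : Type*} [NormedAddCommGroup E] [InnerProductSpace ℝ E]

/-- The optimality condition of the proximal step: `α⁻¹ • (w - y)` is a subgradient of `h` at `y`. -/
theorem subgradient_of_prox_minimizer {h : E → ℝ} (hconv : ConvexOn ℝ Set.univ h) {α : ℝ}
    (hα : 0 < α) {w y : E}
    (hy : ∀ z, h y + (1 / (2 * α)) * ‖y - w‖ ^ 2 ≤ h z + (1 / (2 * α)) * ‖z - w‖ ^ 2) (u : E) :
    h y + ⟪α⁻¹ • (w - y), u - y⟫ ≤ h u := by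
  have key : ∀ t : ℝ, 0 < t → t ≤ 1 →
      h y + ⟪α⁻¹ • (w - y), u - y⟫ ≤ h u + t * ((1 / (2 * α)) * ‖u - y‖ ^ 2) := by
    intro t ht ht1
    have hmin := hy ((1 - t) • y + t • u)
    have hc := hconv.2 (Set.mem_univ y) (Set.mem_univ u) (sub_nonneg.2 ht1) ht.le (by ring)
    have hz : (1 - t) • y + t • u - w = t • (u - y) - (w - y) := by module
    rw [hz, norm_sub_rev y w, norm_sub_sq_real (t • (u - y)), norm_smul, real_inner_smul_left,
      real_inner_comm, mul_pow, Real.norm_eq_abs, sq_abs] at hmin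
    rw [real_inner_smul_left]
    simp only [smul_eq_mul] at hc
    have h2 : 1 / (2 * α) = α⁻¹ / 2 := by field_simp
    rw [h2] at hmin ⊢
    refine le_of_mul_le_mul_left ?_ ht
    nlinarith
  have hlim : Tendsto (fun t : ℝ => h u + t * ((1 / (2 * α)) * ‖u - y‖ ^ 2))
      (nhdsWithin 0 (Set.Ioi 0)) (nhds (h u)) := by
    have : Tendsto (fun t : ℝ => h u + t * ((1 / (2 * α)) * ‖u - y‖ ^ 2))
        (nhds 0) (nhds (h u + 0 * ((1 / (2 * α)) * ‖u - y‖ ^ 2))) :=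
      (Continuous.tendsto (by fun_prop) 0)
    simpa using this.mono_left nhdsWithin_le_nhds
  refine ge_of_tendsto hlim ?_
  filter_upwards [Ioc_mem_nhdsGT (zero_lt_one' ℝ)] with t ht using key t ht.1 ht.2

/-- Proximal steps are nonexpansive. -/
theorem norm_sub_le_of_prox_subgradient {h : E → ℝ} {α : ℝ} (hα : 0 < α) {w₁ w₂ y₁ y₂ : E}
    (h₁ : h y₁ + ⟪α⁻¹ • (w₁ - y₁), y₂ - y₁⟫ ≤ h y₂)
    (h₂ : h y₂ + ⟪α⁻¹ • (w₂ - y₂), y₁ - y₂⟫ ≤ h y₁) :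
    ‖y₁ - y₂‖ ≤ ‖w₁ - w₂‖ := by
  have hsum : α⁻¹ * (‖y₁ - y₂‖ ^ 2 - ⟪w₁ - w₂, y₁ - y₂⟫) ≤ 0 := by
    have e : α⁻¹ * (‖y₁ - y₂‖ ^ 2 - ⟪w₁ - w₂, y₁ - y₂⟫)
        = ⟪α⁻¹ • (w₁ - y₁), y₂ - y₁⟫ + ⟪α⁻¹ • (w₂ - y₂), y₁ - y₂⟫ := by
      rw [← real_inner_self_eq_norm_sq, ← inner_sub_left, ← neg_sub y₁ y₂, inner_neg_right,
        real_inner_smul_left, real_inner_smul_left, ← mul_neg, ← inner_neg_left, ← mul_add,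
        ← inner_add_left]
      congr 2
      abel
    linarith
  have hle : ‖y₁ - y₂‖ ^ 2 ≤ ⟪w₁ - w₂, y₁ - y₂⟫ := by
    have := nonpos_of_mul_nonpos_right hsum (inv_pos.2 hα)
    linarith
  have hcs := real_inner_le_norm (w₁ - w₂) (y₁ - y₂)
  by_contra! hlt
  nlinarith [norm_nonneg (w₁ - w₂), norm_nonneg (y₁ - y₂)]

/-- The descent lemma for a function with Lipschitz gradient. -/
theorem le_add_inner_add_of_lipschitz_gradient [CompleteSpace E] {g : E → ℝ} {G : E → E} {L : ℝ}
    (hgrad : ∀ x, HasGradientAt g (G x) x) (hLip : ∀ x y, ‖G x - G y‖ ≤ L * ‖x - y‖) (x y : E) :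
    g y ≤ g x + ⟪G x, y - x⟫ + L / 2 * ‖y - x‖ ^ 2 := by
  set d := y - x
  let φ : ℝ → ℝ := fun t => g (x + t • d) - t * ⟪G x, d⟫ - L / 2 * ‖d‖ ^ 2 * t ^ 2
  have hderiv : ∀ t, HasDerivAt φ (⟪G (x + t • d), d⟫ - ⟪G x, d⟫ - L * ‖d‖ ^ 2 * t) t := by
    intro t
    have hline : HasDerivAt (fun t : ℝ => x + t • d) d t := by
      simpa using ((hasDerivAt_id t).smul_const d).const_add x
    have hg := (hgrad (x + t • d)).hasFDerivAt.comp_hasDerivAt t hline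
    have := (hg.sub ((hasDerivAt_id t).mul_const ⟪G x, d⟫)).sub
      ((hasDerivAt_pow 2 t).const_mul (L / 2 * ‖d‖ ^ 2))
    refine this.congr_deriv ?_
    simp only [InnerProductSpace.toDual_apply_apply]
    norm_num
    ring
  have hanti : AntitoneOn φ (Set.Icc 0 1) := by
    refine antitoneOn_of_deriv_nonpos (convex_Icc 0 1)
      (fun t _ => (hderiv t).continuousAt.continuousWithinAt)
      (fun t _ => (hderiv t).differentiableAt.differentiableWithinAt) ?_
    intro t ht
    rw [interior_Icc] at ht
    rw [(hderiv t).deriv, ← inner_sub_left]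
    have h1 := real_inner_le_norm (G (x + t • d) - G x) d
    have h2 := hLip (x + t • d) x
    rw [add_sub_cancel_left, norm_smul, Real.norm_eq_abs, abs_of_pos ht.1] at h2
    nlinarith [mul_le_mul_of_nonneg_right h2 (norm_nonneg d)]
  have h01 := hanti (Set.left_mem_Icc.2 zero_le_one) (Set.right_mem_Icc.2 zero_le_one) zero_le_one
  have hy : x + d = y := by simp [d]
  simp only [φ, zero_smul, one_smul, add_zero, hy] at h01
  linarith

/-- The average of points is within the total deviation of any other point. -/
theorem card_mul_norm_average_sub_le {m : ℕ} (hm : 1 ≤ m) (p : Fin m → E) (y : E) :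
    m * ‖(m : ℝ)⁻¹ • ∑ i, p i - y‖ ≤ ∑ i, ‖p i - y‖ := by
  have hm0 : (m : ℝ) ≠ 0 := by positivity
  have : (m : ℝ) • ((m : ℝ)⁻¹ • ∑ i, p i - y) = ∑ i, (p i - y) := by
    rw [smul_sub, smul_inv_smul₀ hm0, Finset.sum_sub_distrib]
    simp [Nat.cast_smul_eq_nsmul]
  calc m * ‖(m : ℝ)⁻¹ • ∑ i, p i - y‖ = ‖∑ i, (p i - y)‖ := by
        rw [← this, norm_smul]; simp
    _ ≤ _ := norm_sum_le _ _

/-- Mixing with weights close to uniform nearly averages. -/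
theorem norm_mix_sub_average_le {m : ℕ} (hm : 1 ≤ m) {w : Fin m → ℝ} {ε : ℝ}
    (hw : ∑ j, w j = 1) (hε : ∀ j, |w j - 1 / (m : ℝ)| ≤ ε) (q : Fin m → E) (c : E) :
    ‖∑ j, w j • q j - (m : ℝ)⁻¹ • ∑ j, q j‖ ≤ ε * ∑ j, ‖q j - c‖ := by
  have hm0 : (m : ℝ) ≠ 0 := by positivity
  have e : ∑ j, w j • q j - (m : ℝ)⁻¹ • ∑ j, q j = ∑ j, (w j - 1 / (m : ℝ)) • (q j - c) := by
    have h0 : ∑ j, (w j - 1 / (m : ℝ)) = 0 := by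
      rw [Finset.sum_sub_distrib, hw]; simp [hm0]
    simp_rw [smul_sub]
    rw [Finset.sum_sub_distrib, ← Finset.sum_smul, h0, zero_smul, sub_zero]
    simp_rw [sub_smul]
    rw [Finset.sum_sub_distrib, Finset.smul_sum, one_div]
  rw [e, Finset.mul_sum]
  refine (norm_sum_le _ _).trans (Finset.sum_le_sum fun j _ => ?_)
  rw [norm_smul, Real.norm_eq_abs]
  exact mul_le_mul_of_nonneg_right (hε j) (norm_nonneg _)

/-- Decrease of `∑ i, g i + m * h` along a proximal step taken from `c` with the gradients evaluated
at nearby points `p i`. -/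
theorem sum_add_le_of_inexact_prox_step [CompleteSpace E] {m : ℕ} (hm : 1 ≤ m) {g : Fin m → E → ℝ}
    {G : Fin m → E → E} {L α : ℝ} (hL : 0 < L) (hα : 0 < α) (hαL : α < 1 / L)
    (hgrad : ∀ i x, HasGradientAt (g i) (G i x) x)
    (hLip : ∀ i x y, ‖G i x - G i y‖ ≤ L * ‖x - y‖) {h : E → ℝ} (p : Fin m → E) (c y : E)
    (hy : h y + ⟪α⁻¹ • (c - α • (m : ℝ)⁻¹ • ∑ i, G i (p i) - y), c - y⟫ ≤ h c) :
    ∑ i, g i y + m * h y + L / 4 * ‖y - c‖ ^ 2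
      ≤ ∑ i, g i c + m * h c + L * (∑ i, ‖p i - c‖) ^ 2 := by
  have hm1 : (1 : ℝ) ≤ m := by exact_mod_cast hm
  have hm0 : (m : ℝ) ≠ 0 := by positivity
  have hLα : L ≤ α⁻¹ := by
    rw [one_div] at hαL
    exact (le_inv_comm₀ hα hL).1 hαL.le
  have hstep : m * h y + ∑ i, ⟪G i (p i), y - c⟫ + m * (α⁻¹ * ‖y - c‖ ^ 2) ≤ m * h c := by
    have e : ⟪α⁻¹ • (c - α • (m : ℝ)⁻¹ • ∑ i, G i (p i) - y), c - y⟫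
        = α⁻¹ * ‖y - c‖ ^ 2 + (m : ℝ)⁻¹ * ∑ i, ⟪G i (p i), y - c⟫ := by
      have : α⁻¹ • (c - α • (m : ℝ)⁻¹ • ∑ i, G i (p i) - y)
          = α⁻¹ • (c - y) - (m : ℝ)⁻¹ • ∑ i, G i (p i) := by
        rw [sub_right_comm, smul_sub, inv_smul_smul₀ hα.ne']
      rw [this, inner_sub_left, real_inner_smul_left, real_inner_smul_left,
        real_inner_self_eq_norm_sq, norm_sub_rev c y, ← sum_inner, ← neg_sub c y, inner_neg_right]
      ring
    rw [e] at hy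
    have := mul_le_mul_of_nonneg_left hy (zero_le_one.trans hm1)
    have e2 : (m : ℝ) * ((m : ℝ)⁻¹ * ∑ i, ⟪G i (p i), y - c⟫) = ∑ i, ⟪G i (p i), y - c⟫ :=
      mul_inv_cancel_left₀ hm0 _
    linarith
  have hsmooth : ∑ i, g i y ≤ ∑ i, g i c + ∑ i, ⟪G i (p i), y - c⟫
      + L * (∑ i, ‖p i - c‖) * ‖y - c‖ + m * (L / 2 * ‖y - c‖ ^ 2) := by
    have hterm : ∀ i, g i y ≤ g i c + ⟪G i (p i), y - c⟫ + L * ‖p i - c‖ * ‖y - c‖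
        + L / 2 * ‖y - c‖ ^ 2 := by
      intro i
      have h1 := le_add_inner_add_of_lipschitz_gradient (hgrad i) (hLip i) c y
      have h2 := real_inner_le_norm (G i c - G i (p i)) (y - c)
      have h3 := mul_le_mul_of_nonneg_right (hLip i c (p i)) (norm_nonneg (y - c))
      rw [inner_sub_left] at h2
      rw [norm_sub_rev c] at h3
      linarith
    refine (Finset.sum_le_sum fun i _ => hterm i).trans_eq ?_
    simp only [Finset.sum_add_distrib, Finset.mul_sum, Finset.sum_mul, Finset.sum_const,
      Finset.card_univ, Fintype.card_fin, nsmul_eq_mul]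
  have hcurv : m * (L / 2 * ‖y - c‖ ^ 2) + L / 2 * ‖y - c‖ ^ 2 ≤ m * (α⁻¹ * ‖y - c‖ ^ 2) := by
    have h1 : (m : ℝ) * (L * ‖y - c‖ ^ 2) ≤ m * (α⁻¹ * ‖y - c‖ ^ 2) := by gcongr
    have h2 : 1 * (L / 2 * ‖y - c‖ ^ 2) ≤ m * (L / 2 * ‖y - c‖ ^ 2) := by gcongr
    linarith
  have hyoung : 0 ≤ L * (‖y - c‖ / 2 - ∑ i, ‖p i - c‖) ^ 2 := by positivity
  nlinarith

end ProximalGradient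

/-- A nonnegative sequence with `D (k + 1) ≤ a * γ ^ k * (D k + B)` is summable. -/
theorem summable_of_le_geometric_mul_add {D : ℕ → ℝ} {a B γ : ℝ} (hD : ∀ k, 0 ≤ D k) (ha : 0 ≤ a)
    (hB : 0 ≤ B) (hγ0 : 0 ≤ γ) (hγ1 : γ < 1) (hrec : ∀ k, D (k + 1) ≤ a * γ ^ k * (D k + B)) :
    Summable D := by
  have hlim : Tendsto (fun k => a * γ ^ k) atTop (nhds 0) := by
    simpa using (tendsto_pow_atTop_nhds_zero_of_lt_one hγ0 hγ1).const_mul a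
  obtain ⟨K, hK⟩ := eventually_atTop.1 (hlim.eventually_le_const (show (0 : ℝ) < 1 / 2 by norm_num))
  set M := max (D K) B
  have hbound : ∀ k, K ≤ k → D k ≤ M := by
    intro k hk
    induction k, hk using Nat.le_induction with
    | base => exact le_max_left _ _
    | succ k hk ih =>
      have hBM : B ≤ M := le_max_right _ _
      nlinarith [hrec k, mul_le_mul_of_nonneg_right (hK k hk) (add_nonneg (hD k) hB)]
  have hgeo : Summable fun k => a * γ ^ k * (M + B) :=
    ((summable_geometric_of_lt_one hγ0 hγ1).mul_left a).mul_right (M + B)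
  rw [← summable_nat_add_iff (K + 1)]
  refine Summable.of_nonneg_of_le (fun k => hD _) (fun k => ?_) ((summable_nat_add_iff K).2 hgeo)
  refine (hrec (k + K)).trans ?_
  have := hbound (k + K) (Nat.le_add_left _ _)
  gcongr

/-- A nonnegative summable sequence is square summable. -/
theorem Summable.sq_of_nonneg {D : ℕ → ℝ} (hs : Summable D) (hD : ∀ k, 0 ≤ D k) :
    Summable fun k => D k ^ 2 := by
  refine (hs.mul_left (∑' k, D k)).of_nonneg_of_le (fun k => sq_nonneg _) fun k => ?_
  rw [sq]
  exact mul_le_mul_of_nonneg_right (hs.le_tsum k fun j _ => hD j) (hD k)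

/-- Summing an inequality that telescopes up to a summable error. -/
theorem sum_range_le_of_le_sub_add {a F s : ℕ → ℝ} {b : ℝ} (hs : Summable s) (hs0 : ∀ k, 0 ≤ s k)
    (hF : ∀ k, b ≤ F k) (hstep : ∀ k, a k ≤ F k - F (k + 1) + s k) (N : ℕ) :
    ∑ k ∈ Finset.range N, a k ≤ F 0 - b + ∑' k, s k := by
  calc ∑ k ∈ Finset.range N, a k ≤ ∑ k ∈ Finset.range N, (F k - F (k + 1) + s k) :=
        Finset.sum_le_sum fun k _ => hstep k
    _ = F 0 - F N + ∑ k ∈ Finset.range N, s k := by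
        rw [Finset.sum_add_distrib, Finset.sum_range_sub']
    _ ≤ F 0 - b + ∑' k, s k := by
        have := hs.sum_le_tsum (Finset.range N) fun k _ => hs0 k
        linarith [hF N]

theorem stmt_19
    (n m : ℕ) (hn : 0 < n) (hm : 1 ≤ m)
    (g : Fin m → EuclideanSpace ℝ (Fin n) → ℝ)
    (G : Fin m → EuclideanSpace ℝ (Fin n) → EuclideanSpace ℝ (Fin n))
    (L Gg Gh α : ℝ) (hL : 0 < L)
    (hgrad : ∀ i x, HasGradientAt (g i) (G i x) x)
    (hLip : ∀ i x y, ‖G i x - G i y‖ ≤ L * ‖x - y‖)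
    (hGg : ∀ i x, ‖G i x‖ ≤ Gg)
    (h : EuclideanSpace ℝ (Fin n) → ℝ)
    (hconv : ConvexOn ℝ Set.univ h)
    (hGh : 0 < Gh)
    (hsub : ∀ x z : EuclideanSpace ℝ (Fin n), (∀ u, h x + ⟪z, u - x⟫ ≤ h u) → ‖z‖ ≤ Gh)
    (hα0 : 0 < α) (hα1 : α < 1 / L)
    (prox : EuclideanSpace ℝ (Fin n) → EuclideanSpace ℝ (Fin n))
    (hprox : ∀ w z, h (prox w) + (1 / (2 * α)) * ‖prox w - w‖ ^ 2
      ≤ h z + (1 / (2 * α)) * ‖z - w‖ ^ 2)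
    (hproxuniq : ∀ w z, (∀ u, h z + (1 / (2 * α)) * ‖z - w‖ ^ 2
      ≤ h u + (1 / (2 * α)) * ‖u - w‖ ^ 2) → z = prox w)
    (lam : ℕ → Fin m → Fin m → ℝ) (Γ γ : ℝ) (hΓ : 0 < Γ) (hγ0 : 0 < γ) (hγ1 : γ < 1)
    (hlamnn : ∀ k, 2 ≤ k → ∀ i j, 0 ≤ lam k i j)
    (hrow : ∀ k, 2 ≤ k → ∀ i, ∑ j, lam k i j = 1)
    (hcol : ∀ k, 2 ≤ k → ∀ j, ∑ i, lam k i j = 1)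
    (hmix : ∀ k, 2 ≤ k → ∀ i j, |lam k i j - 1 / (m : ℝ)| ≤ Γ * γ ^ k)
    (x q v : ℕ → Fin m → EuclideanSpace ℝ (Fin n))
    (hq : ∀ k, 1 ≤ k → ∀ i, q (k + 1) i = x k i - α • G i (x k i))
    (hv : ∀ k, 1 ≤ k → ∀ i, v (k + 1) i = ∑ j, lam (k + 1) i j • q (k + 1) j)
    (hx : ∀ k, 1 ≤ k → ∀ i, x (k + 1) i = prox (v (k + 1) i))
    (xbar : ℕ → EuclideanSpace ℝ (Fin n))
    (hxbar : ∀ k, xbar k = (m : ℝ)⁻¹ • ∑ i, x k i)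
    (gavg f : EuclideanSpace ℝ (Fin n) → ℝ)
    (hgavg : ∀ y, gavg y = (m : ℝ)⁻¹ * ∑ i, g i y)
    (hf : ∀ y, f y = gavg y + h y)
    (xstar : EuclideanSpace ℝ (Fin n))
    (hxstar : ∀ y, f xstar ≤ f y)
    :
    ∃ C : ℝ, 0 ≤ C ∧ ∀ T, 2 ≤ T →
      ∑ k ∈ Finset.Icc 2 T, ‖xbar k - xbar (k - 1)‖ ^ 2 ≤ C := by
  have hm1 : (1 : ℝ) ≤ m := by exact_mod_cast hm
  have hm0 : (m : ℝ) ≠ 0 := by positivity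
  have hGg0 : 0 ≤ Gg := (norm_nonneg _).trans (hGg ⟨0, hm⟩ 0)
  have hsubgrad : ∀ w u, h (prox w) + ⟪α⁻¹ • (w - prox w), u - prox w⟫ ≤ h u := fun w u =>
    subgradient_of_prox_minimizer hconv hα0 (hprox w) u
  have hnonexp : ∀ w₁ w₂, ‖prox w₁ - prox w₂‖ ≤ ‖w₁ - w₂‖ := fun w₁ w₂ =>
    norm_sub_le_of_prox_subgradient hα0 (hsubgrad w₁ _) (hsubgrad w₂ _)
  let qbar : ℕ → EuclideanSpace ℝ (Fin n) := fun k => (m : ℝ)⁻¹ • ∑ i, q (k + 2) i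
  let y : ℕ → EuclideanSpace ℝ (Fin n) := fun k => prox (qbar k)
  -- Consensus error `D`, and mixing error `e` of the step leaving time `k + 1`.
  let D : ℕ → ℝ := fun k => ∑ i, ‖x (k + 1) i - xbar (k + 1)‖
  let e : ℕ → ℝ := fun k => ∑ i, ‖v (k + 2) i - qbar k‖
  have hD0 : ∀ k, 0 ≤ D k := fun k => Finset.sum_nonneg fun i _ => norm_nonneg _
  have he0 : ∀ k, 0 ≤ e k := fun k => Finset.sum_nonneg fun i _ => norm_nonneg _
  have hxy : ∀ k i, ‖x (k + 2) i - y k‖ ≤ ‖v (k + 2) i - qbar k‖ := fun k i => by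
    rw [hx (k + 1) (by omega) i]
    exact hnonexp _ _
  have hxysum : ∀ k, ∑ i, ‖x (k + 2) i - y k‖ ≤ e k := fun k =>
    Finset.sum_le_sum fun i _ => hxy k i
  have hmy : ∀ k, m * ‖xbar (k + 2) - y k‖ ≤ e k := fun k => by
    rw [hxbar]
    exact (card_mul_norm_average_sub_le hm _ _).trans (hxysum k)
  have hye : ∀ k, ‖xbar (k + 2) - y k‖ ≤ e k := fun k =>
    (le_mul_of_one_le_left (norm_nonneg _) hm1).trans (hmy k)
  have hqbar : ∀ k, qbar k
      = xbar (k + 1) - α • (m : ℝ)⁻¹ • ∑ i, G i (x (k + 1) i) := fun k => by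
    simp only [qbar, hq (k + 1) (by omega), hxbar (k + 1)]
    rw [Finset.sum_sub_distrib, smul_sub, ← Finset.smul_sum, smul_comm]
  have heD : ∀ k, e k ≤ (m * Γ * γ ^ 2) * γ ^ k * (D k + m * (α * Gg)) := by
    intro k
    have hdev : ∑ j, ‖q (k + 2) j - xbar (k + 1)‖ ≤ D k + m * (α * Gg) := by
      have hterm : ∀ j, ‖q (k + 2) j - xbar (k + 1)‖
          ≤ ‖x (k + 1) j - xbar (k + 1)‖ + α * Gg := by
        intro j
        rw [hq (k + 1) (by omega), sub_right_comm]
        refine (norm_sub_le _ _).trans ?_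
        rw [norm_smul, Real.norm_eq_abs, abs_of_pos hα0]
        have := hGg j (x (k + 1) j)
        gcongr
      refine (Finset.sum_le_sum fun j _ => hterm j).trans_eq ?_
      simp [D, Finset.sum_add_distrib]
    have hterm : ∀ i, ‖v (k + 2) i - qbar k‖ ≤ Γ * γ ^ (k + 2) * (D k + m * (α * Gg)) := by
      intro i
      rw [hv (k + 1) (by omega)]
      refine (norm_mix_sub_average_le hm (hrow (k + 2) (by omega) i)
        (hmix (k + 2) (by omega) i) _ (xbar (k + 1))).trans ?_
      gcongr
    refine (Finset.sum_le_sum fun i _ => hterm i).trans_eq ?_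
    simp only [Finset.sum_const, Finset.card_univ, Fintype.card_fin, nsmul_eq_mul]
    ring
  have hDe : ∀ k, D (k + 1) ≤ 2 * e k := by
    intro k
    have hterm : ∀ i, ‖x (k + 2) i - xbar (k + 2)‖
        ≤ ‖x (k + 2) i - y k‖ + ‖xbar (k + 2) - y k‖ := fun i => by
      rw [norm_sub_rev (xbar (k + 2))]
      exact norm_sub_le_norm_sub_add_norm_sub _ _ _
    have hsum : D (k + 1) ≤ ∑ i, ‖x (k + 2) i - y k‖ + m * ‖xbar (k + 2) - y k‖ := by
      refine (Finset.sum_le_sum fun i _ => hterm i).trans_eq ?_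
      simp [Finset.sum_add_distrib]
    linarith [hxysum k, hmy k]
  have hDsum : Summable D := by
    refine summable_of_le_geometric_mul_add (a := 2 * (m * Γ * γ ^ 2)) (B := m * (α * Gg)) hD0
      (by positivity) (by positivity) hγ0.le hγ1 fun k => ?_
    linarith [hDe k, heD k]
  have hesum : Summable e := by
    have hdom : Summable fun k => m * Γ * γ ^ 2 * (D k + γ ^ k * (m * (α * Gg))) :=
      (hDsum.add ((summable_geometric_of_lt_one hγ0.le hγ1).mul_right _)).mul_left _
    refine hdom.of_nonneg_of_le he0 fun k => (heD k).trans ?_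
    have hpow : γ ^ k * D k ≤ D k := mul_le_of_le_one_left (hD0 k) (pow_le_one₀ hγ0.le hγ1.le)
    have hc : 0 ≤ m * Γ * γ ^ 2 := by positivity
    nlinarith [mul_le_mul_of_nonneg_left hpow hc]
  let F : EuclideanSpace ℝ (Fin n) → ℝ := fun z => ∑ i, g i z + m * h z
  have hFf : ∀ z, F z = m * f z := fun z => by
    simp only [F, hf, hgavg]
    field_simp
  have hdescent : ∀ k, F (y k) + L / 4 * ‖y k - xbar (k + 1)‖ ^ 2
      ≤ F (xbar (k + 1)) + L * D k ^ 2 := fun k =>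
    sum_add_le_of_inexact_prox_step hm hL hα0 hα1 hgrad hLip (x (k + 1)) (xbar (k + 1)) (y k)
      (by rw [← hqbar]; exact hsubgrad (qbar k) _)
  have hhavg : ∀ k, m * h (xbar (k + 2)) ≤ m * h (y k) + Gh * e k := by
    intro k
    have hjensen : h (xbar (k + 2)) ≤ (m : ℝ)⁻¹ * ∑ i, h (x (k + 2) i) := by
      have := hconv.map_sum_le (t := Finset.univ) (w := fun _ : Fin m => (m : ℝ)⁻¹)
        (p := x (k + 2)) (fun i _ => by positivity) (by simp [hm0]) (fun i _ => Set.mem_univ _)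
      rwa [← Finset.smul_sum, ← Finset.smul_sum, ← hxbar, smul_eq_mul] at this
    have hterm : ∀ i, h (x (k + 2) i) ≤ h (y k) + Gh * ‖v (k + 2) i - qbar k‖ := by
      intro i
      have hs := hsubgrad (v (k + 2) i)
      rw [← hx (k + 1) (by omega) i] at hs
      have hb := hsub _ _ hs
      have hcs := neg_le_of_abs_le (abs_real_inner_le_norm
        (α⁻¹ • (v (k + 2) i - x (k + 2) i)) (y k - x (k + 2) i))
      have hn : ‖y k - x (k + 2) i‖ ≤ ‖v (k + 2) i - qbar k‖ := by
        rw [norm_sub_rev]; exact hxy k i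
      have := mul_le_mul hb hn (norm_nonneg _) hGh.le
      linarith [hs (y k)]
    have hsum : ∑ i, h (x (k + 2) i) ≤ m * h (y k) + Gh * e k := by
      refine (Finset.sum_le_sum fun i _ => hterm i).trans_eq ?_
      simp [e, Finset.sum_add_distrib, Finset.mul_sum]
    have := mul_le_mul_of_nonneg_left hjensen (zero_le_one.trans hm1)
    rw [mul_inv_cancel_left₀ hm0] at this
    linarith
  have hgavg_le : ∀ k, ∑ i, g i (xbar (k + 2))
      ≤ ∑ i, g i (y k) + m * (Gg * e k + L / 2 * e k ^ 2) := by
    intro k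
    have hterm : ∀ i, g i (xbar (k + 2)) ≤ g i (y k) + (Gg * e k + L / 2 * e k ^ 2) := by
      intro i
      have h1 := le_add_inner_add_of_lipschitz_gradient (hgrad i) (hLip i) (y k) (xbar (k + 2))
      have h2 := real_inner_le_norm (G i (y k)) (xbar (k + 2) - y k)
      have h3 := mul_le_mul (hGg i (y k)) (hye k) (norm_nonneg _) hGg0
      have h4 : L / 2 * ‖xbar (k + 2) - y k‖ ^ 2 ≤ L / 2 * e k ^ 2 := by
        have := hye k
        gcongr
      linarith
    refine (Finset.sum_le_sum fun i _ => hterm i).trans_eq ?_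
    simp [Finset.sum_add_distrib, mul_add]
  let s : ℕ → ℝ := fun k =>
    L * D k ^ 2 + Gh * e k + m * (Gg * e k + L / 2 * e k ^ 2) + L / 4 * e k ^ 2
  have hs0 : ∀ k, 0 ≤ s k := fun k => by
    have := he0 k
    positivity
  have hssum : Summable s := by
    have hD2 := hDsum.sq_of_nonneg hD0
    have he2 := hesum.sq_of_nonneg he0
    exact (((hD2.mul_left L).add (hesum.mul_left Gh)).add
      (((hesum.mul_left Gg).add (he2.mul_left (L / 2))).mul_left (m : ℝ))).add (he2.mul_left (L / 4))
  have hstep : ∀ k, L / 8 * ‖xbar (k + 2) - xbar (k + 1)‖ ^ 2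
      ≤ F (xbar (k + 1)) - F (xbar (k + 2)) + s k := by
    intro k
    have htri : ‖xbar (k + 2) - xbar (k + 1)‖ ≤ e k + ‖y k - xbar (k + 1)‖ :=
      (norm_sub_le_norm_sub_add_norm_sub _ (y k) _).trans (add_le_add_left (hye k) _)
    have hsq : ‖xbar (k + 2) - xbar (k + 1)‖ ^ 2
        ≤ 2 * (e k ^ 2 + ‖y k - xbar (k + 1)‖ ^ 2) :=
      (pow_le_pow_left₀ (norm_nonneg _) htri 2).trans add_sq_le
    have hsq' := mul_le_mul_of_nonneg_left hsq (show 0 ≤ L / 8 by positivity)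
    have h1 := hdescent k
    have h2 := hhavg k
    have h3 := hgavg_le k
    simp only [F, s] at h1 ⊢
    linarith
  have hbelow : ∀ k, F xstar ≤ F (xbar (k + 1)) := fun k => by
    rw [hFf, hFf]
    exact mul_le_mul_of_nonneg_left (hxstar _) (zero_le_one.trans hm1)
  have htotal := sum_range_le_of_le_sub_add (F := fun k => F (xbar (k + 1))) hssum hs0 hbelow hstep
  refine ⟨8 / L * (F (xbar 1) - F xstar + ∑' k, s k), ?_, fun T hT => ?_⟩
  · have := htotal 0
    simp only [Finset.range_zero, Finset.sum_empty] at this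
    exact mul_nonneg (by positivity) this
  · have hshift : ∑ k ∈ Finset.Icc 2 T, ‖xbar k - xbar (k - 1)‖ ^ 2
        = ∑ k ∈ Finset.range (T - 1), ‖xbar (k + 2) - xbar (k + 1)‖ ^ 2 := by
      rw [← Finset.Ico_add_one_right_eq_Icc, Finset.sum_Ico_eq_sum_range,
        show T + 1 - 2 = T - 1 by omega]
      refine Finset.sum_congr rfl fun k _ => ?_
      rw [show 2 + k - 1 = k + 1 by omega, add_comm 2 k]
    rw [hshift]
    have := htotal (T - 1)
    rw [← Finset.mul_sum] at this
    calc _ = 8 / L * (L / 8 * ∑ k ∈ Finset.range (T - 1), ‖xbar (k + 2) - xbar (k + 1)‖ ^ 2) := by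
          field_simp
      _ ≤ _ := mul_le_mul_of_nonneg_left this (by positivity)
end
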